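/- Assume the identity matrix I_n together with A_1, …, A_m are linearly independent, and assume b lies in the interior of the moment body ℳ. Then the log-partition function f has a unique global minimizer: there exists exactly one y* ∈ ℝ^m such that f(y*) ≤ f(y) for all y ∈ ℝ^m. -/

import Mathlib

open Matrix Filter
open scoped RealInnerProductSpace

/-- `A(y) = ∑ i, y i • A i`. -/
noncomputable def matA {n m : ℕ} (A : Fin m → Matrix (Fin n) (Fin n) ℝ)
    (y : EuclideanSpace ℝ (Fin m)) : Matrix (Fin n) (Fin n) ℝ :=
  ∑ i, y i • A i

/-- The log-partition function `f(y) = log tr exp A(y) - ⟨b, y⟩`. -/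
noncomputable def logPart {n m : ℕ} (A : Fin m → Matrix (Fin n) (Fin n) ℝ)
    (b : EuclideanSpace ℝ (Fin m)) (y : EuclideanSpace ℝ (Fin m)) : ℝ :=
  Real.log (Matrix.trace (NormedSpace.exp (matA A y))) - ⟪b, y⟫

/-- The linear map `𝒜(X) = (tr(A i * X))_i`. -/
noncomputable def Amap {n m : ℕ} (A : Fin m → Matrix (Fin n) (Fin n) ℝ)
    (X : Matrix (Fin n) (Fin n) ℝ) : EuclideanSpace ℝ (Fin m) :=
  WithLp.toLp 2 (fun i => Matrix.trace (A i * X))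

/-- The spectraplex: symmetric PSD matrices of unit trace. -/
def spectraplex (n : ℕ) : Set (Matrix (Fin n) (Fin n) ℝ) :=
  {X | X.IsSymm ∧ X.PosSemidef ∧ X.trace = 1}

/-- The moment body `ℳ = 𝒜(spectraplex)`. -/
noncomputable def momentBody {n m : ℕ} (A : Fin m → Matrix (Fin n) (Fin n) ℝ) :
    Set (EuclideanSpace ℝ (Fin m)) :=
  Amap A '' spectraplex n

/-- The trace-normalized matrix exponential `X(y)`. -/
noncomputable def densityMat {n m : ℕ} (A : Fin m → Matrix (Fin n) (Fin n) ℝ)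
    (y : EuclideanSpace ℝ (Fin m)) : Matrix (Fin n) (Fin n) ℝ :=
  (Matrix.trace (NormedSpace.exp (matA A y)))⁻¹ • NormedSpace.exp (matA A y)

section SpectralExp

variable {ι : Type*} [Fintype ι] [DecidableEq ι]

/-- Orthogonal diagonalization of a real symmetric matrix. -/
theorem Matrix.IsSymm.exists_orthogonal_diagonalization {H : Matrix ι ι ℝ} (hH : H.IsSymm) :
    ∃ (U : Matrix ι ι ℝ) (d : ι → ℝ), Uᵀ * U = 1 ∧ U * Uᵀ = 1 ∧ H = U * diagonal d * Uᵀ := by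
  have hH' : H.IsHermitian := by
    rw [Matrix.IsHermitian, conjTranspose_eq_transpose_of_trivial]
    exact hH
  refine ⟨hH'.eigenvectorUnitary, hH'.eigenvalues, ?_, ?_, ?_⟩
  · have := Unitary.coe_star_mul_self hH'.eigenvectorUnitary
    rwa [star_eq_conjTranspose, conjTranspose_eq_transpose_of_trivial] at this
  · have := Unitary.coe_mul_star_self hH'.eigenvectorUnitary
    rwa [Unitary.coe_star, star_eq_conjTranspose, conjTranspose_eq_transpose_of_trivial] at this
  · have := hH'.spectral_theorem
    rw [Unitary.conjStarAlgAut_apply, star_eq_conjTranspose,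
      conjTranspose_eq_transpose_of_trivial] at this
    exact this

theorem exp_orthogonal_conj {U : Matrix ι ι ℝ} (h₁ : Uᵀ * U = 1) (h₂ : U * Uᵀ = 1)
    (M : Matrix ι ι ℝ) :
    NormedSpace.exp (U * M * Uᵀ) = U * NormedSpace.exp M * Uᵀ :=
  Matrix.exp_units_conj ⟨U, Uᵀ, h₂, h₁⟩ M

theorem exp_real_diagonal (d : ι → ℝ) :
    NormedSpace.exp (diagonal d) = diagonal fun i => Real.exp (d i) := by
  rw [Matrix.exp_diagonal, Real.exp_eq_exp_ℝ]
  congr 1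
  ext i
  exact Pi.coe_exp d i

theorem orthogonal_conj_diagonal_apply (U : Matrix ι ι ℝ) (d : ι → ℝ) (i j : ι) :
    (U * diagonal d * Uᵀ) i j = ∑ k, U i k * d k * U j k := by
  simp [Matrix.mul_apply (M := U * diagonal d), mul_diagonal]

theorem trace_orthogonal_conj {U : Matrix ι ι ℝ} (h₁ : Uᵀ * U = 1) (M : Matrix ι ι ℝ) :
    (U * M * Uᵀ).trace = M.trace := by
  rw [trace_mul_comm, ← Matrix.mul_assoc, h₁, Matrix.one_mul]

theorem exp_mul_one_add_sub_le (a x : ℝ) : Real.exp a * (1 + x - a) ≤ Real.exp x := by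
  have h := Real.add_one_le_exp (x - a)
  have h' : Real.exp x = Real.exp a * Real.exp (x - a) := by rw [← Real.exp_add]; ring_nf
  rw [h']
  exact mul_le_mul_of_nonneg_left (by linarith) (Real.exp_pos a).le

theorem eq_of_exp_mul_one_add_sub_eq {a x : ℝ} (h : Real.exp x = Real.exp a * (1 + x - a)) :
    x = a := by
  by_contra hne
  have h1 := Real.add_one_lt_exp (sub_ne_zero.2 hne)
  have h' : Real.exp x = Real.exp a * Real.exp (x - a) := by rw [← Real.exp_add]; ring_nf
  rw [h'] at h
  have := mul_left_cancel₀ (Real.exp_pos a).ne' h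
  linarith

/-- Peierls' inequality for a diagonal entry, with its equality case. -/
theorem Matrix.IsSymm.exp_apply_self_le {H : Matrix ι ι ℝ} (hH : H.IsSymm) (i : ι) :
    Real.exp (H i i) ≤ NormedSpace.exp H i i ∧
      (NormedSpace.exp H i i = Real.exp (H i i) → ∀ j, i ≠ j → H i j = 0) := by
  obtain ⟨U, d, h₁, h₂, rfl⟩ := hH.exists_orthogonal_diagonalization
  have hrow : ∀ j, ∑ k, U i k * U j k = (1 : Matrix ι ι ℝ) i j := fun j => by
    rw [← h₂]; simp [Matrix.mul_apply]
  rw [exp_orthogonal_conj h₁ h₂, exp_real_diagonal,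
    orthogonal_conj_diagonal_apply U (fun k => Real.exp (d k)) i i]
  set a := (U * diagonal d * Uᵀ) i i
  have ha' : a = ∑ k, U i k * d k * U i k := orthogonal_conj_diagonal_apply U d i i
  have htangent : ∑ k, U i k * (Real.exp a * (1 + d k - a)) * U i k = Real.exp a := by
    have : ∀ k, U i k * (Real.exp a * (1 + d k - a)) * U i k =
        Real.exp a * ((1 - a) * (U i k * U i k) + U i k * d k * U i k) := fun k => by ring
    simp_rw [this, ← Finset.mul_sum, Finset.sum_add_distrib, ← Finset.mul_sum, hrow i, ← ha']
    simp
  have hle : ∀ k ∈ Finset.univ, U i k * (Real.exp a * (1 + d k - a)) * U i k ≤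
      U i k * Real.exp (d k) * U i k := fun k _ => by
    nlinarith [mul_le_mul_of_nonneg_left (exp_mul_one_add_sub_le a (d k)) (mul_self_nonneg (U i k))]
  refine ⟨htangent.symm.trans_le (Finset.sum_le_sum hle), fun heq j hij => ?_⟩
  have hterm := (Finset.sum_eq_sum_iff_of_le hle).1 (htangent.trans heq.symm)
  have hd : ∀ k, U i k * d k * U j k = a * (U i k * U j k) := fun k => by
    by_cases hk : U i k = 0
    · simp [hk]
    · have h := mul_left_cancel₀ hk (mul_right_cancel₀ hk (hterm k (Finset.mem_univ k)))
      rw [eq_of_exp_mul_one_add_sub_eq h.symm]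
      ring
  rw [orthogonal_conj_diagonal_apply]
  simp_rw [hd, ← Finset.mul_sum, hrow j, Matrix.one_apply_ne hij, mul_zero]

theorem Matrix.IsSymm.trace_exp_pos [Nonempty ι] {H : Matrix ι ι ℝ} (hH : H.IsSymm) :
    0 < (NormedSpace.exp H).trace :=
  Finset.sum_pos (fun i _ => (Real.exp_pos _).trans_le (hH.exp_apply_self_le i).1)
    Finset.univ_nonempty

/-- The Gibbs lower bound `tr (H X) ≤ log tr exp H` for a density matrix `X`. -/
theorem Matrix.IsSymm.trace_mul_le_log_trace_exp {H : Matrix ι ι ℝ} (hH : H.IsSymm)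
    {X : Matrix ι ι ℝ} (hX : X.PosSemidef) (htr : X.trace = 1) :
    (H * X).trace ≤ Real.log (NormedSpace.exp H).trace := by
  obtain ⟨U, d, h₁, h₂, rfl⟩ := hH.exists_orthogonal_diagonalization
  have hY : (Uᵀ * X * U).PosSemidef := by
    have := hX.conjTranspose_mul_mul_same U
    rwa [conjTranspose_eq_transpose_of_trivial] at this
  set Y := Uᵀ * X * U with hYdef
  have hq0 : ∀ k, 0 ≤ Y k k := fun k => hY.diag_nonneg
  have hq1 : ∑ k, Y k k = 1 := by
    change Y.trace = 1
    rw [hYdef, trace_mul_comm, ← Matrix.mul_assoc, h₂, Matrix.one_mul, htr]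
  have htrace : (U * diagonal d * Uᵀ * X).trace = ∑ k, d k * Y k k := by
    rw [Matrix.mul_assoc, Matrix.mul_assoc, trace_mul_comm, Matrix.mul_assoc, ← hYdef]
    simp [Matrix.trace, diagonal_mul]
  have hexp : (NormedSpace.exp (U * diagonal d * Uᵀ)).trace = ∑ k, Real.exp (d k) := by
    rw [exp_orthogonal_conj h₁ h₂, trace_orthogonal_conj h₁, exp_real_diagonal, trace_diagonal]
  have hjensen : Real.exp (∑ k, d k * Y k k) ≤ ∑ k, Real.exp (d k) := by
    have := convexOn_exp.map_sum_le (t := Finset.univ) (w := fun k => Y k k) (p := d)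
      (fun k _ => hq0 k) hq1 (fun _ _ => Set.mem_univ _)
    simp only [smul_eq_mul] at this
    simp_rw [mul_comm (d _)]
    refine this.trans (Finset.sum_le_sum fun k _ => ?_)
    have hk : Y k k ≤ 1 := hq1 ▸
      Finset.single_le_sum (f := fun k => Y k k) (fun k _ => hq0 k) (Finset.mem_univ k)
    exact mul_le_of_le_one_left (Real.exp_pos _).le hk
  rw [htrace, hexp, Real.le_log_iff_exp_le ((Real.exp_pos _).trans_le hjensen)]
  exact hjensen

/-- If `log tr exp` fails to be strictly midpoint convex between two symmetric matrices whose
midpoint is diagonal, then they differ by a multiple of the identity. -/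
theorem sub_eq_smul_one_of_log_trace_exp_diagonal [Nonempty ι] {H K : Matrix ι ι ℝ} {μ : ι → ℝ}
    (hH : H.IsSymm) (hK : K.IsSymm) (hμ : H + K = (2 : ℝ) • diagonal μ)
    (hle : Real.log (NormedSpace.exp H).trace + Real.log (NormedSpace.exp K).trace ≤
      2 * Real.log (NormedSpace.exp (diagonal μ)).trace) :
    ∃ c : ℝ, H - K = c • (1 : Matrix ι ι ℝ) := by
  have hP := hH.trace_exp_pos
  have hQ := hK.trace_exp_pos
  set p := Real.log (NormedSpace.exp H).trace
  set q := Real.log (NormedSpace.exp K).trace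
  have hsum : ∀ (M : Matrix ι ι ℝ), 0 < (NormedSpace.exp M).trace →
      ∑ i, NormedSpace.exp M i i * Real.exp (-Real.log (NormedSpace.exp M).trace) = 1 := by
    intro M hM
    rw [← Finset.sum_mul, Real.exp_neg, Real.exp_log hM]
    exact mul_inv_cancel₀ hM.ne'
  have hdiag : ∀ i, μ i = (H i i + K i i) / 2 := fun i => by
    have := congrFun (congrFun hμ i) i
    simp at this
    linarith
  have hμpos : 0 < (NormedSpace.exp (diagonal μ)).trace :=
    (isSymm_diagonal μ).trace_exp_pos
  have hone : (1 : ℝ) ≤ ∑ i, Real.exp ((H i i - p + (K i i - q)) / 2) := by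
    have : ∀ i, Real.exp ((H i i - p + (K i i - q)) / 2) =
        Real.exp (μ i) * Real.exp (-((p + q) / 2)) := fun i => by
      rw [hdiag, ← Real.exp_add]; ring_nf
    simp_rw [this]
    rw [← hsum (diagonal μ) hμpos]
    refine Finset.sum_le_sum fun i _ => ?_
    rw [exp_real_diagonal, diagonal_apply_eq, ← exp_real_diagonal]
    gcongr
    linarith
  have hle₁ : ∀ i, Real.exp ((H i i - p + (K i i - q)) / 2) ≤
      (Real.exp (H i i - p) + Real.exp (K i i - q)) / 2 := fun i => by
    have h1 : Real.exp (H i i - p) = Real.exp ((H i i - p) / 2) ^ 2 := by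
      rw [← Real.exp_nat_mul]; push_cast; ring_nf
    have h2 : Real.exp (K i i - q) = Real.exp ((K i i - q) / 2) ^ 2 := by
      rw [← Real.exp_nat_mul]; push_cast; ring_nf
    rw [h1, h2, add_div, Real.exp_add]
    nlinarith [sq_nonneg (Real.exp ((H i i - p) / 2) - Real.exp ((K i i - q) / 2))]
  have hHle : ∀ i, Real.exp (H i i - p) ≤ NormedSpace.exp H i i * Real.exp (-p) := fun i => by
    rw [sub_eq_add_neg, Real.exp_add]
    exact mul_le_mul_of_nonneg_right (hH.exp_apply_self_le i).1 (Real.exp_pos _).le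
  have hKle : ∀ i, Real.exp (K i i - q) ≤ NormedSpace.exp K i i * Real.exp (-q) := fun i => by
    rw [sub_eq_add_neg, Real.exp_add]
    exact mul_le_mul_of_nonneg_right (hK.exp_apply_self_le i).1 (Real.exp_pos _).le
  have htot : ∑ i, (NormedSpace.exp H i i * Real.exp (-p) +
      NormedSpace.exp K i i * Real.exp (-q)) / 2 = 1 := by
    rw [← Finset.sum_div, Finset.sum_add_distrib, hsum H hP, hsum K hQ]
    norm_num
  have hle₂ : ∀ i ∈ Finset.univ, Real.exp ((H i i - p + (K i i - q)) / 2) ≤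
      (NormedSpace.exp H i i * Real.exp (-p) + NormedSpace.exp K i i * Real.exp (-q)) / 2 :=
    fun i _ => by linarith [hle₁ i, hHle i, hKle i]
  have heq := (Finset.sum_eq_sum_iff_of_le hle₂).1
    (le_antisymm (Finset.sum_le_sum hle₂) (htot.trans_le hone))
  have hentry : ∀ i, H i i - p = K i i - q ∧ ∀ j, i ≠ j → H i j = 0 := by
    intro i
    have he := heq i (Finset.mem_univ i)
    have e1 := hle₁ i
    have e2 := hHle i
    have e3 := hKle i
    constructor
    · have e4 : Real.exp ((H i i - p + (K i i - q)) / 2) =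
          (Real.exp (H i i - p) + Real.exp (K i i - q)) / 2 := by linarith
      by_contra hne
      have := strictConvexOn_exp.2 (Set.mem_univ (H i i - p)) (Set.mem_univ (K i i - q)) hne
        (by norm_num : (0 : ℝ) < 1 / 2) (by norm_num : (0 : ℝ) < 1 / 2) (by norm_num)
      simp only [smul_eq_mul] at this
      rw [show 1 / 2 * (H i i - p) + 1 / 2 * (K i i - q) = (H i i - p + (K i i - q)) / 2 by ring]
        at this
      linarith
    · apply (hH.exp_apply_self_le i).2
      have e4 : NormedSpace.exp H i i * Real.exp (-p) = Real.exp (H i i) * Real.exp (-p) := by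
        rw [← Real.exp_add, ← sub_eq_add_neg]; linarith
      exact mul_right_cancel₀ (Real.exp_pos _).ne' e4
  refine ⟨p - q, ?_⟩
  ext i j
  by_cases hij : i = j
  · subst hij
    have := (hentry i).1
    simp
    linarith
  · have h1 := (hentry i).2 j hij
    have h2 := congrFun (congrFun hμ i) j
    simp [hij, h1] at h2
    simp [hij, h1, h2]

/-- If `log tr exp` fails to be strictly midpoint convex between two symmetric matrices, then
they differ by a multiple of the identity. -/
theorem sub_eq_smul_one_of_log_trace_exp [Nonempty ι] {H K : Matrix ι ι ℝ}
    (hH : H.IsSymm) (hK : K.IsSymm)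
    (hle : Real.log (NormedSpace.exp H).trace + Real.log (NormedSpace.exp K).trace ≤
      2 * Real.log (NormedSpace.exp ((2⁻¹ : ℝ) • (H + K))).trace) :
    ∃ c : ℝ, H - K = c • (1 : Matrix ι ι ℝ) := by
  obtain ⟨U, μ, h₁, h₂, hM⟩ := ((hH.add hK).smul (2⁻¹ : ℝ)).exists_orthogonal_diagonalization
  have hconj : ∀ M : Matrix ι ι ℝ, U * (Uᵀ * M * U) * Uᵀ = M := fun M => by
    calc U * (Uᵀ * M * U) * Uᵀ = (U * Uᵀ) * M * (U * Uᵀ) := by simp only [Matrix.mul_assoc]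
      _ = M := by simp [h₂]
  have hsymm : ∀ M : Matrix ι ι ℝ, M.IsSymm → (Uᵀ * M * U).IsSymm := fun M hM => by
    simp [Matrix.IsSymm, transpose_mul, hM.eq, Matrix.mul_assoc]
  have htr : ∀ M : Matrix ι ι ℝ,
      (NormedSpace.exp (U * M * Uᵀ)).trace = (NormedSpace.exp M).trace := fun M => by
    rw [exp_orthogonal_conj h₁ h₂, trace_orthogonal_conj h₁]
  have htr' : ∀ M : Matrix ι ι ℝ,
      (NormedSpace.exp (Uᵀ * M * U)).trace = (NormedSpace.exp M).trace := fun M => by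
    rw [← htr, hconj]
  have hμ : Uᵀ * H * U + Uᵀ * K * U = (2 : ℝ) • diagonal μ := by
    have : H + K = (2 : ℝ) • (U * diagonal μ * Uᵀ) := by
      rw [← hM, smul_smul]; norm_num
    calc Uᵀ * H * U + Uᵀ * K * U = Uᵀ * (H + K) * U := by rw [Matrix.mul_add, Matrix.add_mul]
      _ = (2 : ℝ) • ((Uᵀ * U) * diagonal μ * (Uᵀ * U)) := by
        rw [this]; simp only [Matrix.mul_smul, Matrix.smul_mul, Matrix.mul_assoc]
      _ = (2 : ℝ) • diagonal μ := by simp [h₁]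
  obtain ⟨c, hc⟩ := sub_eq_smul_one_of_log_trace_exp_diagonal (hsymm H hH) (hsymm K hK) hμ
    (by rwa [htr', htr', ← htr (diagonal μ), ← hM])
  refine ⟨c, ?_⟩
  rw [← hconj (H - K), Matrix.mul_sub, Matrix.sub_mul, hc]
  simp [h₂]

end SpectralExp

section LogPartition

variable {n m : ℕ} {A : Fin m → Matrix (Fin n) (Fin n) ℝ}

theorem matA_isSymm (hA : ∀ i, (A i)ᵀ = A i) (y : EuclideanSpace ℝ (Fin m)) :
    (matA A y).IsSymm := by
  simp [Matrix.IsSymm, matA, transpose_sum, hA]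

theorem matA_midpoint (x y : EuclideanSpace ℝ (Fin m)) :
    matA A ((2⁻¹ : ℝ) • (x + y)) = (2⁻¹ : ℝ) • (matA A x + matA A y) := by
  simp [matA, ← Finset.sum_add_distrib, Finset.smul_sum, ← add_smul, smul_smul, mul_add]

theorem trace_matA_mul (y : EuclideanSpace ℝ (Fin m)) (X : Matrix (Fin n) (Fin n) ℝ) :
    (matA A y * X).trace = ⟪Amap A X, y⟫ := by
  simp [matA, Amap, Matrix.sum_mul, trace_sum, PiLp.inner_apply, trace_smul]

theorem eq_of_matA_sub_eq_smul_one
    (hind : LinearIndependent ℝ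
      (Fin.cons (1 : Matrix (Fin n) (Fin n) ℝ) A : Fin (m + 1) → Matrix (Fin n) (Fin n) ℝ))
    {x y : EuclideanSpace ℝ (Fin m)} {c : ℝ} (h : matA A x - matA A y = c • 1) : x = y := by
  have h0 := Fintype.linearIndependent_iff.1 hind (Fin.cons (-c) fun i => x i - y i) (by
    simp only [Fin.sum_univ_succ, Fin.cons_zero, Fin.cons_succ, sub_smul, Finset.sum_sub_distrib]
    simp only [matA] at h
    rw [h]
    simp)
  ext i
  have := h0 i.succ
  simp only [Fin.cons_succ] at this
  linarith

theorem continuous_logPart [Nonempty (Fin n)] (hA : ∀ i, (A i)ᵀ = A i)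
    (b : EuclideanSpace ℝ (Fin m)) : Continuous (logPart A b) := by
  have hmat : Continuous (matA A) := by
    unfold matA
    fun_prop
  have hexp : Continuous (NormedSpace.exp : Matrix (Fin n) (Fin n) ℝ → _) := by
    let : NormedRing (Matrix (Fin n) (Fin n) ℝ) := Matrix.linftyOpNormedRing
    let : NormedAlgebra ℝ (Matrix (Fin n) (Fin n) ℝ) := Matrix.linftyOpNormedAlgebra
    let : NormedAlgebra ℚ (Matrix (Fin n) (Fin n) ℝ) := NormedAlgebra.restrictScalars ℚ ℝ _
    exact NormedSpace.exp_continuous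
  unfold logPart
  refine Continuous.sub (Continuous.log (hexp.comp hmat).matrix_trace fun y =>
    (matA_isSymm hA y).trace_exp_pos.ne') (by fun_prop)

/-- `f` grows at least linearly when `b` is interior to the moment body. -/
theorem exists_mul_norm_le_logPart (hA : ∀ i, (A i)ᵀ = A i) {b : EuclideanSpace ℝ (Fin m)}
    (hb : b ∈ interior (momentBody A)) : ∃ ε > 0, ∀ y, ε * ‖y‖ ≤ logPart A b y := by
  obtain ⟨ε, hε, hball⟩ := Metric.nhds_basis_closedBall.mem_iff.1 (mem_interior_iff_mem_nhds.1 hb)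
  refine ⟨ε, hε, fun y => ?_⟩
  obtain ⟨X, ⟨-, hpsd, htr⟩, hX⟩ : b + (ε * ‖y‖⁻¹) • y ∈ momentBody A := by
    apply hball
    rw [Metric.mem_closedBall, dist_eq_norm, add_sub_cancel_left, norm_smul, Real.norm_eq_abs,
      abs_of_nonneg (by positivity), mul_assoc]
    exact mul_le_of_le_one_right hε.le inv_mul_le_one
  have h := (matA_isSymm hA y).trace_mul_le_log_trace_exp hpsd htr
  rw [trace_matA_mul, hX, inner_add_left, real_inner_smul_left, real_inner_self_eq_norm_sq] at h
  have hn : ε * ‖y‖⁻¹ * ‖y‖ ^ 2 = ε * ‖y‖ := by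
    rcases eq_or_ne ‖y‖ 0 with h0 | h0
    · simp [h0]
    · field_simp
  rw [hn] at h
  unfold logPart
  linarith

end LogPartition

/-- unique global minimizer when b is interior. -/
theorem stmt4 (n m : ℕ) (hn : 1 ≤ n)
    (A : Fin m → Matrix (Fin n) (Fin n) ℝ) (hA : ∀ i, (A i)ᵀ = A i)
    (hind : LinearIndependent ℝ
      (Fin.cons (1 : Matrix (Fin n) (Fin n) ℝ) A : Fin (m + 1) → Matrix (Fin n) (Fin n) ℝ))
    (b : EuclideanSpace ℝ (Fin m)) (hb : b ∈ interior (momentBody A)) :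
    ∃! ystar : EuclideanSpace ℝ (Fin m), ∀ y, logPart A b ystar ≤ logPart A b y := by
  have : Nonempty (Fin n) := ⟨⟨0, hn⟩⟩
  obtain ⟨ε, hε, hgrowth⟩ := exists_mul_norm_le_logPart hA hb
  have hcoercive : Tendsto (logPart A b) (cocompact _) atTop :=
    tendsto_atTop_mono hgrowth
      ((tendsto_norm_cocompact_atTop (E := EuclideanSpace ℝ (Fin m))).const_mul_atTop hε)
  obtain ⟨y₀, hy₀⟩ := (continuous_logPart hA b).exists_forall_le hcoercive
  refine ⟨y₀, hy₀, fun y hy => ?_⟩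
  have h₀ := hy₀ ((2⁻¹ : ℝ) • (y + y₀))
  have h₁ := hy ((2⁻¹ : ℝ) • (y + y₀))
  simp only [logPart, matA_midpoint, inner_smul_right, inner_add_right] at h₀ h₁
  obtain ⟨c, hc⟩ := sub_eq_smul_one_of_log_trace_exp (matA_isSymm hA y) (matA_isSymm hA y₀)
    (by linarith)
  exact eq_of_matA_sub_eq_smul_one hind hc
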